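/- For every n ≥ 3 and every ℓ ≥ 3, no (1, ≤ ℓ)-identifying code exists in the cycle C_n on n vertices. -/

import Mathlib

/-- `C` is a `(1, ≤ ℓ)`-identifying code of `G`: for every nonempty set `A` of at most
`ℓ` vertices the set `(∪_{x∈A} B_G(x,1)) ∩ C` is nonempty, and these sets are pairwise
distinct for distinct such `A` (here `B_G(x,1) = N_G[x]`). -/
def IsIdCodeLe {V : Type} (G : SimpleGraph V) (ℓ : ℕ) (C : Finset V) : Prop :=
  (∀ A : Finset V, A.Nonempty → A.card ≤ ℓ → ∃ c ∈ C, ∃ x ∈ A, c = x ∨ G.Adj x c) ∧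
  (∀ A B : Finset V, A.Nonempty → B.Nonempty → A.card ≤ ℓ → B.card ≤ ℓ →
    (∀ c ∈ C, (∃ x ∈ A, c = x ∨ G.Adj x c) ↔ (∃ x ∈ B, c = x ∨ G.Adj x c)) → A = B)

/-- The cycle on `n` vertices `0, 1, …, n−1`, with edges between consecutive vertices
modulo `n`. -/
def cycleG (n : ℕ) : SimpleGraph (Fin n) :=
  SimpleGraph.fromRel (fun i j => ((i : ℕ) + 1) % n = (j : ℕ))

/-- For every `n ≥ 3` and every `ℓ ≥ 3`, no `(1, ≤ ℓ)`-identifying code exists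
in `C_n`. -/
theorem no_idCodeLe_ge_three_cycle (n ℓ : ℕ) (hn : 3 ≤ n) (hℓ : 3 ≤ ℓ) :
    ¬ ∃ C : Finset (Fin n), IsIdCodeLe (cycleG n) ℓ C := by
  rintro ⟨C, -, h⟩
  have key := h {⟨0, by omega⟩, ⟨2, by omega⟩} {⟨0, by omega⟩, ⟨1, by omega⟩, ⟨2, by omega⟩}
    (by simp) (by simp) (Finset.card_le_two.trans (by omega)) (Finset.card_le_three.trans hℓ) ?_
  · have h1 : (⟨1, by omega⟩ : Fin n) ∈
        ({⟨0, by omega⟩, ⟨1, by omega⟩, ⟨2, by omega⟩} : Finset (Fin n)) := by simp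
    rw [← key] at h1
    simp at h1
  · intro c _
    constructor
    · rintro ⟨x, hx, hc⟩
      refine ⟨x, ?_, hc⟩
      simp only [Finset.mem_insert, Finset.mem_singleton] at hx ⊢
      tauto
    · rintro ⟨x, hx, hc⟩
      simp only [Finset.mem_insert, Finset.mem_singleton] at hx
      rcases hx with rfl | rfl | rfl
      · exact ⟨_, by simp, hc⟩
      · have h2 : c = ⟨0, by omega⟩ ∨ c = ⟨1, by omega⟩ ∨ c = ⟨2, by omega⟩ := by
          rcases hc with hc | hc
          · exact Or.inr (Or.inl hc)
          · rw [cycleG, SimpleGraph.fromRel_adj] at hc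
            obtain ⟨-, hc | hc⟩ := hc
            · right; right
              ext
              simp only at hc ⊢
              rw [← hc, Nat.mod_eq_of_lt (by omega)]
            · left
              ext
              simp only at hc ⊢
              have hlt := c.isLt
              rcases Nat.lt_or_ge ((c : ℕ) + 1) n with h3 | h3
              · rw [Nat.mod_eq_of_lt h3] at hc
                omega
              · have h4 : (c : ℕ) + 1 = n := by omega
                rw [h4, Nat.mod_self] at hc
                omega
        rcases h2 with rfl | rfl | rfl
        · exact ⟨_, by simp, Or.inl rfl⟩
        · refine ⟨⟨0, by omega⟩, by simp, Or.inr ?_⟩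
          rw [cycleG, SimpleGraph.fromRel_adj]
          refine ⟨by simp, Or.inl ?_⟩
          simp only
          rw [Nat.mod_eq_of_lt (by omega)]
        · exact ⟨⟨2, by omega⟩, by simp, Or.inl rfl⟩
      · exact ⟨⟨2, by omega⟩, by simp, hc⟩
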